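/- Let k be a field of characteristic not 2, and let q_1, q_2 ∈ k^* each admit a square root in k. Let a_1, a_2 ∈ k[h^{±1}] be nonzero. Then the generalized Weyl algebras k[h_1^{±1}](σ_inv, a_1) with σ_inv(h_1) = q_1 h_1^{-1} and k[h_2^{±1}](σ'_inv, a_2) with σ'_inv(h_2) = q_2 h_2^{-1} are isomorphic as k-algebras if and only if there exist p ∈ k^*, l ∈ ℤ, τ ∈ {0,1}, ε ∈ {1,−1}, and α ∈ k with α^2 = q_1 q_2^{−ε}, such that a_2(q_2^τ h_2^{(−1)^τ}) = p h_2^l a_1(α h_2^{ε}) in k[h_2^{±1}]. -/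

import Mathlib

open LaurentPolynomial

/-- The defining relations of the degree-one generalized Weyl algebra `k[h^{±1}](σ, a)`:
the generators `Sum.inl p` (for `p` a Laurent polynomial) give a copy of `k[h^{±1}]`,
and the generators `x = Sum.inr 0` and `y = Sum.inr 1` satisfy
`y x = a`, `x y = σ a`, `x r = σ(r) x` and `y r = σ⁻¹(r) y` for all `r ∈ k[h^{±1}]`. -/
inductive GWARel (k : Type*) [CommRing k] (σ : LaurentPolynomial k ≃ₐ[k] LaurentPolynomial k)
    (a : LaurentPolynomial k) :
    FreeAlgebra k (LaurentPolynomial k ⊕ Fin 2) →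
      FreeAlgebra k (LaurentPolynomial k ⊕ Fin 2) → Prop
  | add (r s : LaurentPolynomial k) :
      GWARel k σ a (FreeAlgebra.ι k (Sum.inl (r + s)))
        (FreeAlgebra.ι k (Sum.inl r) + FreeAlgebra.ι k (Sum.inl s))
  | mul (r s : LaurentPolynomial k) :
      GWARel k σ a (FreeAlgebra.ι k (Sum.inl (r * s)))
        (FreeAlgebra.ι k (Sum.inl r) * FreeAlgebra.ι k (Sum.inl s))
  | smul (c : k) (r : LaurentPolynomial k) :
      GWARel k σ a (FreeAlgebra.ι k (Sum.inl (c • r))) (c • FreeAlgebra.ι k (Sum.inl r))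
  | one : GWARel k σ a (FreeAlgebra.ι k (Sum.inl 1)) 1
  | xr (r : LaurentPolynomial k) :
      GWARel k σ a (FreeAlgebra.ι k (Sum.inr 0) * FreeAlgebra.ι k (Sum.inl r))
        (FreeAlgebra.ι k (Sum.inl (σ r)) * FreeAlgebra.ι k (Sum.inr 0))
  | yr (r : LaurentPolynomial k) :
      GWARel k σ a (FreeAlgebra.ι k (Sum.inr 1) * FreeAlgebra.ι k (Sum.inl r))
        (FreeAlgebra.ι k (Sum.inl (σ.symm r)) * FreeAlgebra.ι k (Sum.inr 1))
  | yx : GWARel k σ a (FreeAlgebra.ι k (Sum.inr 1) * FreeAlgebra.ι k (Sum.inr 0))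
        (FreeAlgebra.ι k (Sum.inl a))
  | xy : GWARel k σ a (FreeAlgebra.ι k (Sum.inr 0) * FreeAlgebra.ι k (Sum.inr 1))
        (FreeAlgebra.ι k (Sum.inl (σ a)))

/-- The degree-one generalized Weyl algebra `k[h^{±1}](σ, a)`, presented as the quotient of
the free algebra on `k[h^{±1}] ⊕ {x, y}` by the generalized Weyl relations. -/
abbrev GWA (k : Type*) [CommRing k] (σ : LaurentPolynomial k ≃ₐ[k] LaurentPolynomial k)
    (a : LaurentPolynomial k) :=
  RingQuot (GWARel k σ a)

namespace GWA

variable {k : Type*} [CommRing k] (σ : LaurentPolynomial k ≃ₐ[k] LaurentPolynomial k)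
  (a : LaurentPolynomial k)

/-- The copy of the Laurent polynomial `p` inside the generalized Weyl algebra. -/
noncomputable def r (p : LaurentPolynomial k) : GWA k σ a :=
  RingQuot.mkAlgHom k (GWARel k σ a) (FreeAlgebra.ι k (Sum.inl p))

/-- The element `h` of the generalized Weyl algebra. -/
noncomputable def H : GWA k σ a := r σ a (T 1)

/-- The element `h⁻¹` of the generalized Weyl algebra. -/
noncomputable def Hinv : GWA k σ a := r σ a (T (-1))

/-- The generator `x` of the generalized Weyl algebra. -/
noncomputable def x : GWA k σ a :=
  RingQuot.mkAlgHom k (GWARel k σ a) (FreeAlgebra.ι k (Sum.inr 0))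

/-- The generator `y` of the generalized Weyl algebra. -/
noncomputable def y : GWA k σ a :=
  RingQuot.mkAlgHom k (GWARel k σ a) (FreeAlgebra.ι k (Sum.inr 1))

end GWA

/-- An element `a ∈ k[h^{±1}]` is a monomial if `a = c·hⁱ` for some `c ∈ k`, `i ∈ ℤ`. -/
def LaurentPolynomial.IsMonomial {k : Type*} [CommRing k] (a : LaurentPolynomial k) : Prop :=
  ∃ (c : k) (i : ℤ), a = C c * T i

namespace LaurentPolynomial

theorem algHom_ext_T {k B : Type*} [CommRing k] [Semiring B] [Algebra k B]
    {f g : LaurentPolynomial k →ₐ[k] B} (h : f (T 1) = g (T 1)) : f = g := by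
  refine AddMonoidAlgebra.algHom_ext' (MonoidHom.ext_mint h) ?_
  ext

theorem exists_algHom_T {k B : Type*} [CommRing k] [Semiring B] [Algebra k B] (w : Bˣ) :
    ∃ f : LaurentPolynomial k →ₐ[k] B, f (T 1) = w := by
  refine ⟨AddMonoidAlgebra.lift k B ℤ ((Units.coeHom B).comp (zpowersHom Bˣ w)), ?_⟩
  rw [T, AddMonoidAlgebra.lift_single]
  simp

variable {k : Type*} [Field k]

theorem isUnit_C_mul_T {c : k} (hc : c ≠ 0) (n : ℤ) : IsUnit (C c * T n : LaurentPolynomial k) :=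
  ((isUnit_iff_ne_zero.2 hc).map C).mul (isUnit_T n)

theorem C_mul_T_inj {c d : k} (hc : c ≠ 0) {m n : ℤ}
    (h : (C c * T m : LaurentPolynomial k) = C d * T n) : c = d ∧ m = n := by
  rw [← single_eq_C_mul_T, ← single_eq_C_mul_T] at h
  have h' := congrArg AddMonoidAlgebra.coeff h
  simp only [AddMonoidAlgebra.coeff_single] at h'
  rcases Finsupp.single_eq_single_iff .. |>.1 h' with h | h
  · exact ⟨h.2, h.1⟩
  · exact absurd h.1 hc

/-- An algebra homomorphism with `h ↦ c hⁱ` sends `hⁿ` to `cⁿ hⁱⁿ`. -/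
theorem algHom_T {f : LaurentPolynomial k →ₐ[k] LaurentPolynomial k} {c : k} {i : ℤ}
    (hc : c ≠ 0) (h : f (T 1) = C c * T i) (n : ℤ) : f (T n) = C (c ^ n) * T (i * n) := by
  have hnat (n : ℕ) : f (T n) = C (c ^ (n : ℤ)) * T (i * n) := by
    rw [zpow_natCast, mul_comm i, ← T_pow, map_pow C, ← mul_pow, ← h, ← map_pow, T_pow, mul_one]
  obtain ⟨m, rfl | rfl⟩ := n.eq_nat_or_neg
  · exact hnat m
  · have h1 : f (T m) * f (T (-m)) = 1 := by rw [← map_mul, ← T_add]; simp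
    have h2 : (C (c ^ (m : ℤ)) * T (i * m)) * (C (c ^ (-m : ℤ)) * T (i * -m)) = 1 := by
      rw [mul_mul_mul_comm, ← map_mul, ← T_add, ← zpow_add₀ hc]
      simp
    rw [hnat] at h1
    exact (isUnit_C_mul_T (zpow_ne_zero _ hc) _).mul_left_cancel (h1.trans h2.symm)

theorem algHom_C_mul_T {f : LaurentPolynomial k →ₐ[k] LaurentPolynomial k} {c : k} {i : ℤ}
    (hc : c ≠ 0) (h : f (T 1) = C c * T i) (d : k) (n : ℤ) :
    f (C d * T n) = C (d * c ^ n) * T (i * n) := by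
  have hC : f (C d) = C d := f.commutes d
  rw [map_mul, algHom_T hc h, hC, ← mul_assoc, ← map_mul]

theorem isUnit_iff_exists_C_mul_T {f : LaurentPolynomial k} :
    IsUnit f ↔ ∃ (c : k) (n : ℤ), c ≠ 0 ∧ f = C c * T n := by
  refine ⟨fun hf ↦ ?_, ?_⟩
  · obtain ⟨g, hg⟩ := hf.exists_right_inv
    have hf0 : f ≠ 0 := hf.ne_zero
    have hg0 : g ≠ 0 := right_ne_zero_of_mul_eq_one hg
    have hcf : f.coeff.support.Nonempty := by
      rwa [Finsupp.support_nonempty_iff, Ne, AddMonoidAlgebra.coeff_eq_zero]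
    have hcg : g.coeff.support.Nonempty := by
      rwa [Finsupp.support_nonempty_iff, Ne, AddMonoidAlgebra.coeff_eq_zero]
    have hcard : ¬ 1 < f.coeff.support.card * g.coeff.support.card := by
      intro hc
      obtain ⟨p, hp, q, hq, hpq, hup, huq⟩ := TwoUniqueSums.uniqueAdd_of_one_lt_card hc
      have key (p : ℤ × ℤ) (hp : p ∈ f.coeff.support ×ˢ g.coeff.support)
          (hup : UniqueAdd f.coeff.support g.coeff.support p.1 p.2) : p.1 + p.2 = 0 := by
        by_contra hne
        rw [Finset.mem_product, Finsupp.mem_support_iff, Finsupp.mem_support_iff] at hp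
        have h := AddMonoidAlgebra.coeff_mul_add_of_uniqueAdd hup
        rw [hg, AddMonoidAlgebra.one_def, AddMonoidAlgebra.coeff_single,
          Finsupp.single_eq_of_ne hne] at h
        exact mul_ne_zero hp.1 hp.2 h.symm
      have h1 := Finset.mem_product.1 hp
      have h2 := Finset.mem_product.1 hq
      have := huq h1.1 h1.2 ((key p hp hup).trans (key q hq huq).symm)
      exact hpq (Prod.ext this.1 this.2)
    have hf1 : f.coeff.support.card = 1 := by
      have := hcf.card_pos
      have := hcg.card_pos
      nlinarith
    obtain ⟨n, c, hc, h⟩ := Finsupp.card_support_eq_one'.1 hf1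
    refine ⟨c, n, hc, ?_⟩
    rw [← single_eq_C_mul_T]
    exact LaurentPolynomial.ext fun a ↦ by rw [h]; rfl
  · rintro ⟨c, n, hc, rfl⟩
    exact isUnit_C_mul_T hc n

end LaurentPolynomial

namespace SkewMonoidAlgebra

variable {R G : Type*} [Ring R] [Group G] [MulSemiringAction G R]

theorem coeff_mul_mul_of_uniqueMul {f g : SkewMonoidAlgebra R G} {a b : G}
    (h : UniqueMul f.support g.support a b) :
    (f * g).coeff (a * b) = f.coeff a * a • g.coeff b := by
  classical
  rw [coeff_mul, sum_def, Finsupp.sum]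
  simp only [sum_def, Finsupp.sum]
  rw [← Finset.sum_product']
  refine (Finset.sum_eq_single (a, b) ?_ ?_).trans (if_pos rfl) <;> simp_rw [Finset.mem_product]
  · refine fun ab hab hne ↦ if_neg (fun he ↦ hne <| Prod.ext ?_ ?_)
    exacts [(h hab.1 hab.2 he).1, (h hab.1 hab.2 he).2]
  · refine fun hnotMem ↦ ite_eq_right_iff.mpr (fun _ ↦ ?_)
    rcases not_and_or.mp hnotMem with af | bg
    · rw [Finsupp.notMem_support_iff.mp af, zero_mul]
    · rw [Finsupp.notMem_support_iff.mp bg, smul_zero, mul_zero]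

/-- Over a group with two unique products, the factors of a nonzero homogeneous element are
homogeneous. -/
theorem exists_single_of_mul_eq_single [NoZeroDivisors R] [TwoUniqueProds G]
    {f g : SkewMonoidAlgebra R G} {c : G} {d : R} (hd : d ≠ 0) (h : f * g = single c d) :
    ∃ (a b : G) (r s : R), f = single a r ∧ g = single b s ∧ a * b = c ∧ r * a • s = d := by
  have h0 : f * g ≠ 0 := by rwa [h, Ne, single_eq_zero]
  have hcf : f.support.Nonempty := by
    rw [Finset.nonempty_iff_ne_empty, Ne, support_eq_empty]
    exact left_ne_zero_of_mul h0
  have hcg : g.support.Nonempty := by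
    rw [Finset.nonempty_iff_ne_empty, Ne, support_eq_empty]
    exact right_ne_zero_of_mul h0
  have hcard : ¬ 1 < f.support.card * g.support.card := by
    intro hc
    obtain ⟨p, hp, q, hq, hpq, hup, huq⟩ := TwoUniqueProds.uniqueMul_of_one_lt_card hc
    have key (p : G × G) (hp : p ∈ f.support ×ˢ g.support)
        (hup : UniqueMul f.support g.support p.1 p.2) : p.1 * p.2 = c := by
      by_contra hne
      rw [Finset.mem_product, mem_support_iff, mem_support_iff] at hp
      have h' := coeff_mul_mul_of_uniqueMul hup
      rw [h, coeff_single, Finsupp.single_eq_of_ne hne] at h'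
      exact mul_ne_zero hp.1 ((smul_ne_zero_iff_ne _).2 hp.2) h'.symm
    have h1 := Finset.mem_product.1 hp
    have h2 := Finset.mem_product.1 hq
    have := huq h1.1 h1.2 ((key p hp hup).trans (key q hq huq).symm)
    exact hpq (Prod.ext this.1 this.2)
  have hpf := hcf.card_pos
  have hpg := hcg.card_pos
  have hf1 : f.support.card = 1 := by nlinarith
  have hg1 : g.support.card = 1 := by nlinarith
  obtain ⟨a, r, hr, hf⟩ := Finsupp.card_support_eq_one'.1 hf1
  obtain ⟨b, s, hs, hg⟩ := Finsupp.card_support_eq_one'.1 hg1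
  have hf' : f = single a r := coeff_injective hf
  have hg' : g = single b s := coeff_injective hg
  refine ⟨a, b, r, s, hf', hg', ?_⟩
  rw [hf', hg', single_mul_single] at h
  have h' := congrArg coeff h
  simp only [coeff_single] at h'
  rcases Finsupp.single_eq_single_iff .. |>.1 h' with h | h
  · exact h
  · exact absurd h.2 hd

end SkewMonoidAlgebra

namespace GWA

section Presentation

variable {k : Type*} [CommRing k] (σ : LaurentPolynomial k ≃ₐ[k] LaurentPolynomial k)
  (a : LaurentPolynomial k)

/-- The structure map `k[h^{±1}] → k[h^{±1}](σ, a)` as an algebra homomorphism. -/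
noncomputable def rHom : LaurentPolynomial k →ₐ[k] GWA k σ a :=
  AlgHom.ofLinearMap
    { toFun := r σ a
      map_add' := fun p q ↦ by
        have := RingQuot.mkAlgHom_rel k (GWARel.add (σ := σ) (a := a) p q)
        simp only [map_add] at this
        exact this
      map_smul' := fun c p ↦ by
        have := RingQuot.mkAlgHom_rel k (GWARel.smul (σ := σ) (a := a) c p)
        simp only [map_smul] at this
        exact this }
    (by
      have := RingQuot.mkAlgHom_rel k (GWARel.one (σ := σ) (a := a))
      simp only [map_one] at this
      exact this)
    (fun p q ↦ by
      have := RingQuot.mkAlgHom_rel k (GWARel.mul (σ := σ) (a := a) p q)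
      simp only [map_mul] at this
      exact this)

theorem x_mul_rHom (p : LaurentPolynomial k) :
    x σ a * rHom σ a p = rHom σ a (σ p) * x σ a := by
  have := RingQuot.mkAlgHom_rel k (GWARel.xr (σ := σ) (a := a) p)
  simp only [map_mul] at this
  exact this

theorem y_mul_rHom (p : LaurentPolynomial k) :
    y σ a * rHom σ a p = rHom σ a (σ.symm p) * y σ a := by
  have := RingQuot.mkAlgHom_rel k (GWARel.yr (σ := σ) (a := a) p)
  simp only [map_mul] at this
  exact this

theorem y_mul_x : y σ a * x σ a = rHom σ a a := by
  have := RingQuot.mkAlgHom_rel k (GWARel.yx (σ := σ) (a := a))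
  simp only [map_mul] at this
  exact this

theorem x_mul_y : x σ a * y σ a = rHom σ a (σ a) := by
  have := RingQuot.mkAlgHom_rel k (GWARel.xy (σ := σ) (a := a))
  simp only [map_mul] at this
  exact this

variable {σ a} {B : Type*} [Semiring B] [Algebra k B]

/-- The universal property of the generalized Weyl algebra. -/
theorem exists_algHom (f : LaurentPolynomial k →ₐ[k] B) (u v : B)
    (hu : ∀ p, u * f p = f (σ p) * u) (hv : ∀ p, v * f p = f (σ.symm p) * v)
    (hvu : v * u = f a) (huv : u * v = f (σ a)) :
    ∃ F : GWA k σ a →ₐ[k] B, (∀ p, F (rHom σ a p) = f p) ∧ F (x σ a) = u ∧ F (y σ a) = v := by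
  let F₀ : FreeAlgebra k (LaurentPolynomial k ⊕ Fin 2) →ₐ[k] B :=
    FreeAlgebra.lift k (Sum.elim f ![u, v])
  have hF₀ : ∀ ⦃z w⦄, GWARel k σ a z w → F₀ z = F₀ w := by
    intro z w h
    cases h <;> simp [F₀, hu, hv, hvu, huv]
  refine ⟨RingQuot.liftAlgHom k ⟨F₀, hF₀⟩, fun p ↦ ?_, ?_, ?_⟩
  · exact (RingQuot.liftAlgHom_mkAlgHom_apply _ _ hF₀ _).trans (by simp [F₀])
  · exact (RingQuot.liftAlgHom_mkAlgHom_apply _ _ hF₀ _).trans (by simp [F₀])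
  · exact (RingQuot.liftAlgHom_mkAlgHom_apply _ _ hF₀ _).trans (by simp [F₀])

theorem algHom_ext {f g : GWA k σ a →ₐ[k] B} (hr : ∀ p, f (rHom σ a p) = g (rHom σ a p))
    (hx : f (x σ a) = g (x σ a)) (hy : f (y σ a) = g (y σ a)) : f = g := by
  apply RingQuot.ringQuot_ext'
  apply FreeAlgebra.hom_ext
  funext i
  rcases i with p | i
  · exact hr p
  · fin_cases i
    · exact hx
    · exact hy

variable (σ a) in
/-- The homogeneous generators: `xⁿ` in degree `n ≥ 0` and `yⁿ` in degree `-n < 0`. -/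
noncomputable def gen : ℤ → GWA k σ a
  | Int.ofNat n => x σ a ^ n
  | Int.negSucc n => y σ a ^ (n + 1)

theorem x_mul_gen (n : ℤ) : ∃ p, x σ a * gen σ a n = rHom σ a p * gen σ a (n + 1) := by
  rcases n with n | n
  · exact ⟨1, by rw [map_one, one_mul]; exact (pow_succ' _ _).symm⟩
  · refine ⟨σ a, ?_⟩
    have h : gen σ a (Int.negSucc n + 1) = y σ a ^ n := by
      cases n with
      | zero => simp [gen]
      | succ n => rfl
    rw [h, ← x_mul_y, mul_assoc, ← pow_succ']
    rfl

theorem y_mul_gen (n : ℤ) : ∃ p, y σ a * gen σ a n = rHom σ a p * gen σ a (n - 1) := by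
  rcases n with n | n
  · cases n with
    | zero =>
      have h : y σ a * x σ a ^ 0 = y σ a ^ (0 + 1) := by simp
      exact ⟨1, by rw [map_one, one_mul]; exact h⟩
    | succ n =>
      refine ⟨a, ?_⟩
      have h : gen σ a (Int.ofNat (n + 1) - 1) = x σ a ^ n := by
        rw [show Int.ofNat (n + 1) - 1 = Int.ofNat n by simp]
        rfl
      rw [h, ← y_mul_x, mul_assoc, ← pow_succ']
      rfl
  · exact ⟨1, by rw [map_one, one_mul]; exact (pow_succ' _ _).symm⟩

/-- The generalized Weyl algebra is spanned over `k[h^{±1}]` by the homogeneous generators. -/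
theorem exists_eq_sum (w : GWA k σ a) :
    ∃ F : ℤ →₀ LaurentPolynomial k, w = F.sum fun n p ↦ rHom σ a p * gen σ a n := by
  let Θ : (ℤ →₀ LaurentPolynomial k) →+ GWA k σ a :=
    Finsupp.liftAddHom fun n ↦
      (AddMonoidHom.mulRight (gen σ a n)).comp (rHom σ a : LaurentPolynomial k →+ GWA k σ a)
  have hΘ (n : ℤ) (p : LaurentPolynomial k) :
      Θ (Finsupp.single n p) = rHom σ a p * gen σ a n := by simp [Θ]
  have hr (p : LaurentPolynomial k) (F) : ∃ F', Θ F' = rHom σ a p * Θ F := by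
    induction F using Finsupp.induction_linear with
    | zero => exact ⟨0, by simp⟩
    | add f g hf hg =>
      obtain ⟨f', hf⟩ := hf
      obtain ⟨g', hg⟩ := hg
      exact ⟨f' + g', by rw [map_add, map_add, hf, hg, mul_add]⟩
    | single n q => exact ⟨Finsupp.single n (p * q), by rw [hΘ, hΘ, map_mul, mul_assoc]⟩
  have hx (F) : ∃ F', Θ F' = x σ a * Θ F := by
    induction F using Finsupp.induction_linear with
    | zero => exact ⟨0, by simp⟩
    | add f g hf hg =>
      obtain ⟨f', hf⟩ := hf
      obtain ⟨g', hg⟩ := hg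
      exact ⟨f' + g', by rw [map_add, map_add, hf, hg, mul_add]⟩
    | single n q =>
      obtain ⟨p, hp⟩ := x_mul_gen (σ := σ) (a := a) n
      exact ⟨Finsupp.single (n + 1) (σ q * p), by
        rw [hΘ, hΘ, map_mul, mul_assoc, ← hp, ← mul_assoc, ← mul_assoc, x_mul_rHom]⟩
  have hy (F) : ∃ F', Θ F' = y σ a * Θ F := by
    induction F using Finsupp.induction_linear with
    | zero => exact ⟨0, by simp⟩
    | add f g hf hg =>
      obtain ⟨f', hf⟩ := hf
      obtain ⟨g', hg⟩ := hg
      exact ⟨f' + g', by rw [map_add, map_add, hf, hg, mul_add]⟩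
    | single n q =>
      obtain ⟨p, hp⟩ := y_mul_gen (σ := σ) (a := a) n
      exact ⟨Finsupp.single (n - 1) (σ.symm q * p), by
        rw [hΘ, hΘ, map_mul, mul_assoc, ← hp, ← mul_assoc, ← mul_assoc, y_mul_rHom]⟩
  have hmul (z : FreeAlgebra k (LaurentPolynomial k ⊕ Fin 2)) :
      ∀ F, ∃ F', Θ F' = RingQuot.mkAlgHom k (GWARel k σ a) z * Θ F := by
    induction z using FreeAlgebra.induction with
    | grade0 c =>
      intro F
      obtain ⟨F', h⟩ := hr (algebraMap k _ c) F
      exact ⟨F', by rw [h, AlgHom.commutes, AlgHom.commutes]⟩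
    | grade1 i =>
      rcases i with p | i
      · exact hr p
      · fin_cases i
        · exact hx
        · exact hy
    | mul z w hz hw =>
      intro F
      obtain ⟨F', h⟩ := hw F
      obtain ⟨F'', h'⟩ := hz F'
      exact ⟨F'', by rw [h', h, map_mul, mul_assoc]⟩
    | add z w hz hw =>
      intro F
      obtain ⟨F', h⟩ := hz F
      obtain ⟨F'', h'⟩ := hw F
      exact ⟨F' + F'', by rw [map_add, h', h, map_add, add_mul]⟩
  obtain ⟨z, rfl⟩ := RingQuot.mkAlgHom_surjective k (GWARel k σ a) w
  obtain ⟨F, hF⟩ := hmul z (Finsupp.single 0 1)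
  refine ⟨F, ?_⟩
  have h1 : Θ (Finsupp.single 0 1) = 1 := by
    rw [hΘ, map_one, one_mul]
    exact pow_zero _
  rw [h1, mul_one] at hF
  rw [← hF]
  rfl

end Presentation

section Isomorphisms

variable {k : Type*} [CommRing k] {σ σ₁ σ₂ : LaurentPolynomial k ≃ₐ[k] LaurentPolynomial k}
  {a a₁ a₂ : LaurentPolynomial k}

/-- An equivariant automorphism of `k[h^{±1}]` matching `a₁` with `a₂` up to a unit induces a
homomorphism of generalized Weyl algebras fixing `x`. -/
theorem exists_algHom_of_equivariant (ψ : LaurentPolynomial k ≃ₐ[k] LaurentPolynomial k)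
    (hψ : ∀ p, ψ (σ₁ p) = σ₂ (ψ p)) (u : LaurentPolynomial k) (h : ψ a₁ = u * a₂) :
    ∃ F : GWA k σ₁ a₁ →ₐ[k] GWA k σ₂ a₂, (∀ p, F (rHom σ₁ a₁ p) = rHom σ₂ a₂ (ψ p)) ∧
      F (x σ₁ a₁) = x σ₂ a₂ ∧ F (y σ₁ a₁) = rHom σ₂ a₂ u * y σ₂ a₂ := by
  have hψ' (p) : σ₂.symm (ψ p) = ψ (σ₁.symm p) := by
    rw [AlgEquiv.symm_apply_eq, ← hψ, AlgEquiv.apply_symm_apply]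
  have hf (p) : ((rHom σ₂ a₂).comp ψ.toAlgHom) p = rHom σ₂ a₂ (ψ p) := rfl
  refine exists_algHom ((rHom σ₂ a₂).comp ψ.toAlgHom) _ _ (fun p ↦ ?_) (fun p ↦ ?_) ?_ ?_ <;>
    simp only [hf]
  · rw [x_mul_rHom, hψ]
  · rw [mul_assoc, y_mul_rHom, hψ', ← mul_assoc, ← mul_assoc, ← map_mul, ← map_mul, mul_comm u]
  · rw [mul_assoc, y_mul_x, ← map_mul, h]
  · rw [← mul_assoc, x_mul_rHom, mul_assoc, x_mul_y, ← map_mul, hψ, h, map_mul σ₂]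

theorem nonempty_algEquiv_of_equivariant (ψ : LaurentPolynomial k ≃ₐ[k] LaurentPolynomial k)
    (hψ : ∀ p, ψ (σ₁ p) = σ₂ (ψ p)) (u : (LaurentPolynomial k)ˣ) (h : ψ a₁ = u * a₂) :
    Nonempty (GWA k σ₁ a₁ ≃ₐ[k] GWA k σ₂ a₂) := by
  have hψ' (p) : ψ.symm (σ₂ p) = σ₁ (ψ.symm p) := by
    rw [AlgEquiv.symm_apply_eq, hψ, AlgEquiv.apply_symm_apply]
  have h' : ψ.symm a₂ = ψ.symm ↑u⁻¹ * a₁ := by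
    rw [AlgEquiv.symm_apply_eq, map_mul, AlgEquiv.apply_symm_apply, h, Units.inv_mul_cancel_left]
  obtain ⟨F, hFr, hFx, hFy⟩ := exists_algHom_of_equivariant ψ hψ u h
  obtain ⟨F', hFr', hFx', hFy'⟩ := exists_algHom_of_equivariant ψ.symm hψ' _ h'
  refine ⟨AlgEquiv.ofAlgHom F F' (algHom_ext (fun p ↦ ?_) ?_ ?_)
    (algHom_ext (fun p ↦ ?_) ?_ ?_)⟩
  · simp [hFr, hFr']
  · simp [hFx, hFx']
  · rw [AlgHom.comp_apply, hFy', map_mul, hFr, hFy, AlgEquiv.apply_symm_apply, ← mul_assoc,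
      ← map_mul, Units.inv_mul, map_one, one_mul, AlgHom.id_apply]
  · simp [hFr, hFr']
  · simp [hFx, hFx']
  · rw [AlgHom.comp_apply, hFy, map_mul, hFr', hFy', ← mul_assoc, ← map_mul, ← map_mul,
      Units.mul_inv, map_one, map_one, one_mul, AlgHom.id_apply]

/-- When `σ` is an involution, exchanging `x` and `y` exchanges `a` and `σ(a)`. -/
theorem exists_algHom_swap {a b : LaurentPolynomial k} (hσ : ∀ p, σ (σ p) = p) (hab : σ a = b) :
    ∃ F : GWA k σ a →ₐ[k] GWA k σ b, (∀ p, F (rHom σ a p) = rHom σ b p) ∧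
      F (x σ a) = y σ b ∧ F (y σ a) = x σ b := by
  have hσ' (p) : σ.symm p = σ p := by rw [AlgEquiv.symm_apply_eq, hσ]
  apply exists_algHom (rHom σ b)
  · intro p
    rw [y_mul_rHom, hσ']
  · intro p
    rw [x_mul_rHom, hσ']
  · rw [x_mul_y, ← hab, hσ]
  · rw [y_mul_x, hab]

theorem nonempty_algEquiv_swap (hσ : ∀ p, σ (σ p) = p) :
    Nonempty (GWA k σ (σ a) ≃ₐ[k] GWA k σ a) := by
  obtain ⟨F, hFr, hFx, hFy⟩ := exists_algHom_swap (a := σ a) (b := a) hσ (hσ a)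
  obtain ⟨F', hFr', hFx', hFy'⟩ := exists_algHom_swap (a := a) (b := σ a) hσ rfl
  refine ⟨AlgEquiv.ofAlgHom F F' (algHom_ext (fun p ↦ ?_) ?_ ?_)
    (algHom_ext (fun p ↦ ?_) ?_ ?_)⟩ <;> simp [hFr, hFr', hFx, hFx', hFy, hFy']

end Isomorphisms

end GWA

/-- The infinite cyclic group acting on `k[h^{±1}]` through the powers of `σ`. -/
def ZAct {k : Type*} [CommRing k] (_σ : LaurentPolynomial k ≃ₐ[k] LaurentPolynomial k) :=
  Multiplicative ℤ

namespace ZAct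

variable {k : Type*} [CommRing k] (σ : LaurentPolynomial k ≃ₐ[k] LaurentPolynomial k)

instance : CommGroup (ZAct σ) := inferInstanceAs (CommGroup (Multiplicative ℤ))

instance : TwoUniqueProds (ZAct σ) := inferInstanceAs (TwoUniqueProds (Multiplicative ℤ))

/-- The generator of the infinite cyclic group, acting by `σ`. -/
def g : ZAct σ := Multiplicative.ofAdd (1 : ℤ)

theorem exists_eq_zpow (c : ZAct σ) : ∃ n : ℤ, c = g σ ^ n :=
  ⟨Multiplicative.toAdd c, (Int.ofAdd_mul 1 (Multiplicative.toAdd c)).symm ▸ by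
    rw [one_mul]; rfl⟩

theorem zpow_inj {m n : ℤ} (h : g σ ^ m = g σ ^ n) : m = n := by
  have h' : Multiplicative.ofAdd (1 : ℤ) ^ m = Multiplicative.ofAdd (1 : ℤ) ^ n := h
  simpa using congrArg Multiplicative.toAdd h'

noncomputable instance : MulSemiringAction (ZAct σ) (LaurentPolynomial k) :=
  MulSemiringAction.compHom (LaurentPolynomial k)
    (zpowersHom (LaurentPolynomial k ≃ₐ[k] LaurentPolynomial k) σ)

theorem g_smul (p : LaurentPolynomial k) : g σ • p = σ p := by
  have : zpowersHom (LaurentPolynomial k ≃ₐ[k] LaurentPolynomial k) σ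
      (Multiplicative.ofAdd (1 : ℤ)) = σ := by simp
  exact DFunLike.congr_fun this p

theorem g_inv_smul (p : LaurentPolynomial k) : (g σ)⁻¹ • p = σ.symm p := by
  rw [inv_smul_eq_iff, g_smul, AlgEquiv.apply_symm_apply]

instance : SMulCommClass (ZAct σ) k (LaurentPolynomial k) where
  smul_comm c t p := by
    exact map_smul (zpowersHom (LaurentPolynomial k ≃ₐ[k] LaurentPolynomial k) σ c) t p

end ZAct

namespace GWA

open SkewMonoidAlgebra ZAct

section Embedding

variable {k : Type*} [CommRing k] {σ : LaurentPolynomial k ≃ₐ[k] LaurentPolynomial k}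
  {a : LaurentPolynomial k}

variable (σ a) in
/-- The generalized Weyl algebra maps to the skew Laurent ring `k[h^{±1}][X^{±1}; σ]` by
`x ↦ X`, `y ↦ a X⁻¹`. -/
theorem exists_toSkew : ∃ N : GWA k σ a →ₐ[k] SkewMonoidAlgebra (LaurentPolynomial k) (ZAct σ),
    (∀ p, N (rHom σ a p) = single 1 p) ∧ N (x σ a) = single (g σ) 1 ∧
      N (y σ a) = single (g σ)⁻¹ a := by
  let f : LaurentPolynomial k →ₐ[k] SkewMonoidAlgebra (LaurentPolynomial k) (ZAct σ) :=
    AlgHom.ofLinearMap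
      { toFun := single 1
        map_add' := single_add 1
        map_smul' := fun c p ↦ (smul_single c 1 p).symm }
      rfl (fun p q ↦ by
        change single 1 (p * q) = single 1 p * single 1 q
        rw [single_mul_single, one_smul, one_mul])
  have hf (p) : f p = single 1 p := rfl
  refine exists_algHom f _ _ (fun p ↦ ?_) (fun p ↦ ?_) ?_ ?_ <;>
    simp only [hf, single_mul_single, mul_one, one_mul, one_smul, g_smul, g_inv_smul,
      mul_inv_cancel, inv_mul_cancel, smul_one]
  rw [mul_comm]

variable (σ a) in
/-- The homomorphism to the skew Laurent ring given by `x ↦ X`, `y ↦ a X⁻¹`. -/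
noncomputable def toSkew :
    GWA k σ a →ₐ[k] SkewMonoidAlgebra (LaurentPolynomial k) (ZAct σ) :=
  (exists_toSkew σ a).choose

theorem toSkew_rHom (p) : toSkew σ a (rHom σ a p) = single 1 p :=
  (exists_toSkew σ a).choose_spec.1 p

theorem toSkew_x : toSkew σ a (x σ a) = single (g σ) 1 :=
  (exists_toSkew σ a).choose_spec.2.1

theorem toSkew_y : toSkew σ a (y σ a) = single (g σ)⁻¹ a :=
  (exists_toSkew σ a).choose_spec.2.2

theorem rHom_injective : Function.Injective (rHom σ a) := fun p q h ↦ by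
  have := congrArg (toSkew σ a) h
  rw [toSkew_rHom, toSkew_rHom] at this
  exact single_injective 1 this

theorem exists_single_pow [IsDomain k] (c : ZAct σ) (r : LaurentPolynomial k) (m : ℕ) :
    ∃ s, (single c r : SkewMonoidAlgebra (LaurentPolynomial k) (ZAct σ)) ^ m = single (c ^ m) s ∧
      (m ≠ 0 → r ∣ s) ∧ (r ≠ 0 → s ≠ 0) := by
  induction m with
  | zero => exact ⟨1, by rw [pow_zero, pow_zero]; rfl, by simp, by simp⟩
  | succ m ih =>
    obtain ⟨s, hs, -, hs0⟩ := ih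
    refine ⟨r * c • s, ?_, fun _ ↦ dvd_mul_right _ _, fun hr ↦ ?_⟩
    · rw [pow_succ', hs, single_mul_single, pow_succ']
    · exact mul_ne_zero hr ((smul_ne_zero_iff_ne _).2 (hs0 hr))

theorem toSkew_gen [IsDomain k] (ha : a ≠ 0) (n : ℤ) :
    ∃ c, c ≠ 0 ∧ toSkew σ a (gen σ a n) = single (g σ ^ n) c := by
  rcases n with n | n
  · obtain ⟨s, hs, -, hs0⟩ := exists_single_pow (g σ) 1 n
    refine ⟨s, hs0 one_ne_zero, ?_⟩
    rw [Int.ofNat_eq_natCast, zpow_natCast, ← hs, ← toSkew_x (a := a), ← map_pow]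
    rfl
  · obtain ⟨s, hs, -, hs0⟩ := exists_single_pow (g σ)⁻¹ a (n + 1)
    refine ⟨s, hs0 ha, ?_⟩
    rw [zpow_negSucc, ← inv_pow, ← hs, ← toSkew_y, ← map_pow]
    rfl

theorem toSkew_injective [IsDomain k] (ha : a ≠ 0) : Function.Injective (toSkew σ a) := by
  rw [injective_iff_map_eq_zero]
  intro w hw
  obtain ⟨F, rfl⟩ := exists_eq_sum w
  choose c hc0 hc using toSkew_gen (σ := σ) ha
  have hF : F = 0 := by
    ext1 n
    have h := congrArg (fun f ↦ f.coeff (g σ ^ n)) hw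
    simp only [Finsupp.sum, _root_.map_sum, map_mul, toSkew_rHom, hc, single_mul_single, one_mul,
      one_smul] at h
    rw [← coeffAddEquiv_apply, _root_.map_sum, Finsupp.finsetSum_apply, Finset.sum_eq_single n] at h
    · simpa [hc0] using h
    · intro m _ hm
      rw [coeffAddEquiv_apply, coeff_single]
      exact Finsupp.single_eq_of_ne fun h ↦ hm (zpow_inj σ h).symm
    · intro hn
      simp [Finsupp.notMem_support_iff.1 hn]
  rw [hF, Finsupp.sum_zero_index]

/-- Constraints on the coefficients of the image of a homomorphism to a skew Laurent ring sending
`x` to `r Xⁿ` and `y` to `s X⁻ⁿ`. -/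
theorem coeff_algHom [IsDomain k] {σ' : LaurentPolynomial k ≃ₐ[k] LaurentPolynomial k}
    {θ : GWA k σ a →ₐ[k] SkewMonoidAlgebra (LaurentPolynomial k) (ZAct σ')}
    {ψ : LaurentPolynomial k →ₐ[k] LaurentPolynomial k} {n : ℤ} {r s : LaurentPolynomial k}
    (hr : ∀ p, θ (rHom σ a p) = single 1 (ψ p)) (hx : θ (x σ a) = single (g σ' ^ n) r)
    (hy : θ (y σ a) = single (g σ' ^ (-n)) s) (w : GWA k σ a) (j : ℤ) :
    ((θ w).coeff (g σ' ^ j) ≠ 0 → n ∣ j) ∧ (0 < j * n → r ∣ (θ w).coeff (g σ' ^ j)) ∧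
      (j * n < 0 → s ∣ (θ w).coeff (g σ' ^ j)) := by
  obtain ⟨F, rfl⟩ := exists_eq_sum w
  rw [map_finsuppSum, ← coeffAddEquiv_apply, map_finsuppSum, Finsupp.sum,
    Finsupp.finsetSum_apply]
  have key (m : ℤ) (p : LaurentPolynomial k) :
      ((θ (rHom σ a p * gen σ a m)).coeff (g σ' ^ j) ≠ 0 → n ∣ j) ∧
      (0 < j * n → r ∣ (θ (rHom σ a p * gen σ a m)).coeff (g σ' ^ j)) ∧
      (j * n < 0 → s ∣ (θ (rHom σ a p * gen σ a m)).coeff (g σ' ^ j)) := by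
    have hgen : ∃ t, θ (gen σ a m) = single (g σ' ^ (n * m)) t ∧ (0 < m → r ∣ t) ∧
        (m < 0 → s ∣ t) := by
      rcases m with m | m
      · obtain ⟨t, ht, hdvd, -⟩ := exists_single_pow (g σ' ^ n) r m
        refine ⟨t, ?_, fun h ↦ hdvd ?_, fun h ↦ ?_⟩
        · rw [Int.ofNat_eq_natCast, zpow_mul, zpow_natCast, ← ht, ← hx, ← map_pow]
          rfl
        · rintro rfl; simp at h
        · simp at h; omega
      · obtain ⟨t, ht, hdvd, -⟩ := exists_single_pow (g σ' ^ (-n)) s (m + 1)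
        refine ⟨t, ?_, fun h ↦ ?_, fun h ↦ hdvd (by omega)⟩
        · rw [zpow_mul, zpow_negSucc, ← inv_pow, ← zpow_neg, ← ht, ← hy, ← map_pow]
          rfl
        · exact absurd h (by simp)
    obtain ⟨t, ht, hrt, hst⟩ := hgen
    rw [map_mul, hr, ht, single_mul_single, one_mul, one_smul, coeff_single]
    by_cases hj : j = n * m
    · subst hj
      rw [Finsupp.single_eq_same]
      refine ⟨fun _ ↦ dvd_mul_right _ _, fun h ↦ (hrt ?_).mul_left _, fun h ↦ (hst ?_).mul_left _⟩
      · by_contra! hm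
        nlinarith [mul_self_nonneg n]
      · by_contra! hm
        nlinarith [mul_self_nonneg n]
    · rw [Finsupp.single_eq_of_ne fun h ↦ hj (zpow_inj σ' h)]
      simp
  refine ⟨fun h ↦ ?_, fun h ↦ ?_, fun h ↦ ?_⟩
  · obtain ⟨m, -, hm⟩ := Finset.exists_ne_zero_of_sum_ne_zero h
    exact (key _ _).1 hm
  · exact Finset.dvd_sum fun m _ ↦ (key _ _).2.1 h
  · exact Finset.dvd_sum fun m _ ↦ (key _ _).2.2 h

theorem dvd_coeff_toSkew [IsDomain k] (w : GWA k σ a) {j : ℤ} (hj : j < 0) :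
    a ∣ (toSkew σ a w).coeff (g σ ^ j) :=
  (coeff_algHom (ψ := AlgHom.id k _) (n := 1) (r := 1) (s := a) (θ := toSkew σ a)
    toSkew_rHom (by rw [zpow_one, toSkew_x]) (by rw [zpow_neg_one, toSkew_y]) w j).2.2 (by omega)

/-- If `a` is not a unit, then the units of the generalized Weyl algebra lie in `k[h^{±1}]`. -/
theorem exists_rHom_eq_of_isUnit [IsDomain k] (ha0 : a ≠ 0) (ha : ¬IsUnit a) {w : GWA k σ a}
    (hw : IsUnit w) : ∃ p, IsUnit p ∧ w = rHom σ a p := by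
  obtain ⟨v, hwv, hvw⟩ := isUnit_iff_exists.1 hw
  have h := congrArg (toSkew σ a) hwv
  rw [map_mul, map_one, SkewMonoidAlgebra.one_def] at h
  obtain ⟨c, d, r, s, hc, hd, hcd, hrs⟩ := exists_single_of_mul_eq_single one_ne_zero h
  have hr : IsUnit r := IsUnit.of_mul_eq_one _ hrs
  have hs : IsUnit s := by
    have : IsUnit (c • s) := IsUnit.of_mul_eq_one r (by rw [mul_comm, hrs])
    have h' := this.map (MulSemiringAction.toRingHom (ZAct σ) (LaurentPolynomial k) c⁻¹)
    simpa using h'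
  obtain ⟨n, rfl⟩ := exists_eq_zpow σ c
  have hd' : d = g σ ^ (-n) := by rw [zpow_neg, eq_inv_of_mul_eq_one_right hcd]
  subst hd'
  have hn : n = 0 := by
    rcases lt_trichotomy n 0 with hn | hn | hn
    · have := dvd_coeff_toSkew w hn
      rw [hc, coeff_single, Finsupp.single_eq_same] at this
      exact absurd (isUnit_of_dvd_unit this hr) ha
    · exact hn
    · have := dvd_coeff_toSkew v (neg_lt_zero.2 hn)
      rw [hd, coeff_single, Finsupp.single_eq_same] at this
      exact absurd (isUnit_of_dvd_unit this hs) ha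
  subst hn
  exact ⟨r, hr, toSkew_injective ha0 (by rw [hc, toSkew_rHom, zpow_zero])⟩

end Embedding

end GWA

namespace GWA

open SkewMonoidAlgebra ZAct

section Involution

variable {k : Type*} [Field k] {σ σ₁ σ₂ : LaurentPolynomial k ≃ₐ[k] LaurentPolynomial k}
  {a a₁ a₂ : LaurentPolynomial k} {q q₁ q₂ : k}

theorem apply_apply_of_involution (hq : q ≠ 0) (hσ : σ (T 1) = C q * T (-1))
    (p : LaurentPolynomial k) : σ (σ p) = p := by
  have hσ' : (σ : LaurentPolynomial k →ₐ[k] LaurentPolynomial k) (T 1) = C q * T (-1) := hσ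
  have h : (σ : LaurentPolynomial k →ₐ[k] LaurentPolynomial k).comp σ = AlgHom.id k _ := by
    apply algHom_ext_T
    rw [AlgHom.comp_apply, hσ', algHom_C_mul_T hq hσ']
    simp [hq]
  exact DFunLike.congr_fun h p

/-- A homomorphism into a generalized Weyl algebra with `a₂` not a unit maps `k[h^{±1}]` to
`k[h^{±1}]`. -/
theorem exists_restriction (ha₂ : a₂ ≠ 0) (hu₂ : ¬IsUnit a₂)
    (φ : GWA k σ₁ a₁ →ₐ[k] GWA k σ₂ a₂) :
    ∃ (ψ : LaurentPolynomial k →ₐ[k] LaurentPolynomial k) (α : k) (i : ℤ),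
      α ≠ 0 ∧ ψ (T 1) = C α * T i ∧ ∀ p, φ (rHom σ₁ a₁ p) = rHom σ₂ a₂ (ψ p) := by
  have hw : IsUnit (φ (rHom σ₁ a₁ (T 1))) := ((isUnit_T 1).map (rHom σ₁ a₁)).map φ
  obtain ⟨p, hp, hpw⟩ := exists_rHom_eq_of_isUnit ha₂ hu₂ hw
  obtain ⟨α, i, hα, rfl⟩ := isUnit_iff_exists_C_mul_T.1 hp
  obtain ⟨ψ, hψ⟩ := exists_algHom_T (k := k) hp.unit
  have hψ' : ψ (T 1) = C α * T i := hψ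
  refine ⟨ψ, α, i, hα, hψ', ?_⟩
  have h : φ.comp (rHom σ₁ a₁) = (rHom σ₂ a₂).comp ψ :=
    algHom_ext_T (by rw [AlgHom.comp_apply, AlgHom.comp_apply, hpw, hψ'])
  exact DFunLike.congr_fun h

theorem isUnit_of_algEquiv (hσ₁ : σ₁ (T 1) ≠ T 1) (ha₂ : a₂ ≠ 0)
    (φ : GWA k σ₁ a₁ ≃ₐ[k] GWA k σ₂ a₂) (hu₁ : IsUnit a₁) : IsUnit a₂ := by
  by_contra hu₂
  have hx : IsUnit (x σ₁ a₁) := by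
    have hxy : IsUnit (x σ₁ a₁ * y σ₁ a₁) := by
      rw [x_mul_y]
      exact (hu₁.map σ₁).map (rHom σ₁ a₁)
    have hyx : IsUnit (y σ₁ a₁ * x σ₁ a₁) := by
      rw [y_mul_x]
      exact hu₁.map (rHom σ₁ a₁)
    obtain ⟨v, hv⟩ := hxy.exists_right_inv
    obtain ⟨w, hw⟩ := hyx.exists_left_inv
    rw [mul_assoc] at hv
    rw [← mul_assoc] at hw
    exact isUnit_iff_exists_and_exists.2 ⟨⟨_, hv⟩, ⟨_, hw⟩⟩
  obtain ⟨p, -, hp⟩ := exists_rHom_eq_of_isUnit ha₂ hu₂ (hx.map φ)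
  obtain ⟨ψ, -, -, -, -, hψ⟩ := exists_restriction ha₂ hu₂ (φ : GWA k σ₁ a₁ →ₐ[k] GWA k σ₂ a₂)
  have hψ' (p) : φ (rHom σ₁ a₁ p) = rHom σ₂ a₂ (ψ p) := hψ p
  have hcomm : x σ₁ a₁ * rHom σ₁ a₁ (T 1) = rHom σ₁ a₁ (T 1) * x σ₁ a₁ := by
    apply φ.injective
    rw [map_mul, map_mul, hp, hψ', ← map_mul, ← map_mul, mul_comm]
  rw [x_mul_rHom] at hcomm
  exact hσ₁ (rHom_injective (hx.mul_right_cancel hcomm))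

/-- An isomorphism of generalized Weyl algebras, with `a₁` and `a₂` not units and `σ₂` an
involution, restricts to an equivariant map of `k[h^{±1}]` matching up `a₁` with `a₂` or
`σ₂ a₂`. -/
theorem exists_associated_of_algEquiv (ha₁ : a₁ ≠ 0) (ha₂ : a₂ ≠ 0) (hu₁ : ¬IsUnit a₁)
    (hu₂ : ¬IsUnit a₂) (hσ₂ : ∀ p, σ₂ (σ₂ p) = p) (φ : GWA k σ₁ a₁ ≃ₐ[k] GWA k σ₂ a₂) :
    ∃ (ψ : LaurentPolynomial k →ₐ[k] LaurentPolynomial k) (α : k) (i : ℤ),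
      α ≠ 0 ∧ (i = 1 ∨ i = -1) ∧ ψ (T 1) = C α * T i ∧ (∀ p, ψ (σ₁ p) = σ₂ (ψ p)) ∧
        (Associated a₂ (ψ a₁) ∨ Associated (σ₂ a₂) (ψ a₁)) := by
  obtain ⟨ψ, α, i, hα, hψT, hψ⟩ :=
    exists_restriction ha₂ hu₂ (φ : GWA k σ₁ a₁ →ₐ[k] GWA k σ₂ a₂)
  obtain ⟨ψ', α', i', hα', hψT', hψ'⟩ :=
    exists_restriction ha₁ hu₁ (φ.symm : GWA k σ₂ a₂ →ₐ[k] GWA k σ₁ a₁)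
  replace hψ (p) : φ (rHom σ₁ a₁ p) = rHom σ₂ a₂ (ψ p) := hψ p
  replace hψ' (p) : φ.symm (rHom σ₂ a₂ p) = rHom σ₁ a₁ (ψ' p) := hψ' p
  have hψψ (p) : ψ' (ψ p) = p := by
    apply rHom_injective (σ := σ₁) (a := a₁)
    rw [← hψ', ← hψ, AlgEquiv.symm_apply_apply]
  have hi : i = 1 ∨ i = -1 := by
    have h := hψψ (T 1)
    rw [hψT, algHom_C_mul_T hα' hψT'] at h
    have h' := (C_mul_T_inj (d := 1) (n := 1) (mul_ne_zero hα (zpow_ne_zero i hα'))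
      (by rw [h, map_one, one_mul])).2
    exact Int.eq_one_or_neg_one_of_mul_eq_one' (by rwa [mul_comm] at h') |>.imp (·.1) (·.1)
  have hψa : ψ a₁ ≠ 0 := fun h ↦ ha₁ (by rw [← hψψ a₁, h, map_zero])
  have hyx : toSkew σ₂ a₂ (φ (y σ₁ a₁)) * toSkew σ₂ a₂ (φ (x σ₁ a₁)) = single 1 (ψ a₁) := by
    rw [← map_mul, ← map_mul, y_mul_x, hψ, toSkew_rHom]
  obtain ⟨b, c, s, r, hs, hr, hbc, hsr⟩ := exists_single_of_mul_eq_single hψa hyx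
  obtain ⟨n, rfl⟩ := exists_eq_zpow σ₂ c
  have hb : b = g σ₂ ^ (-n) := by rw [zpow_neg, eq_inv_of_mul_eq_one_left hbc]
  subst hb
  have hr0 : r ≠ 0 := by
    rintro rfl
    rw [smul_zero, mul_zero] at hsr
    exact hψa hsr.symm
  have hequiv (p) : g σ₂ ^ n • ψ p = ψ (σ₁ p) := by
    have h := congrArg (fun w ↦ toSkew σ₂ a₂ (φ w)) (x_mul_rHom σ₁ a₁ p)
    simp only [map_mul, hψ, hr, toSkew_rHom, single_mul_single, one_mul, mul_one, one_smul] at h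
    have h' := single_injective _ h
    rw [mul_comm] at h'
    exact mul_right_cancel₀ hr0 h'
  let θ : GWA k σ₁ a₁ →ₐ[k] SkewMonoidAlgebra (LaurentPolynomial k) (ZAct σ₂) :=
    (toSkew σ₂ a₂).comp (φ : GWA k σ₁ a₁ →ₐ[k] GWA k σ₂ a₂)
  have hθ (p) : θ (rHom σ₁ a₁ p) = single 1 (ψ p) := by
    rw [← toSkew_rHom (a := a₂), ← hψ]
    rfl
  have hθx := coeff_algHom hθ hr hs (φ.symm (x σ₂ a₂)) 1
  have hx : (θ (φ.symm (x σ₂ a₂))).coeff (g σ₂ ^ (1 : ℤ)) = 1 := by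
    change (toSkew σ₂ a₂ (φ (φ.symm (x σ₂ a₂)))).coeff _ = 1
    rw [AlgEquiv.apply_symm_apply, toSkew_x, coeff_single, zpow_one, Finsupp.single_eq_same]
  have hθy := coeff_algHom hθ hr hs (φ.symm (y σ₂ a₂)) (-1)
  have hy : (θ (φ.symm (y σ₂ a₂))).coeff (g σ₂ ^ (-1 : ℤ)) = a₂ := by
    change (toSkew σ₂ a₂ (φ (φ.symm (y σ₂ a₂)))).coeff _ = a₂
    rw [AlgEquiv.apply_symm_apply, toSkew_y, coeff_single, zpow_neg_one, Finsupp.single_eq_same]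
  rw [hx] at hθx
  rw [hy] at hθy
  have hσ₂' (p) : σ₂.symm p = σ₂ p := by rw [AlgEquiv.symm_apply_eq, hσ₂]
  rcases Int.isUnit_iff.1 (isUnit_of_dvd_one (hθx.1 one_ne_zero)) with rfl | rfl
  · refine ⟨ψ, α, i, hα, hi, hψT, fun p ↦ ?_, Or.inl ?_⟩
    · rw [← hequiv, zpow_one, g_smul]
    · have hru : IsUnit r := isUnit_of_dvd_one (hθx.2.1 (by norm_num))
      have hsa : s ∣ a₂ := hθy.2.2 (by norm_num)
      have has : a₂ ∣ s := by
        have h := dvd_coeff_toSkew (φ (y σ₁ a₁)) (j := -1) (by norm_num)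
        rwa [hs, coeff_single, Finsupp.single_eq_same] at h
      rw [← hsr, zpow_neg_one, g_inv_smul]
      exact (associated_of_dvd_dvd has hsa).trans
        (associated_mul_unit_right s _ (hru.map σ₂.symm))
  · refine ⟨ψ, α, i, hα, hi, hψT, fun p ↦ ?_, Or.inr ?_⟩
    · rw [← hequiv, zpow_neg_one, g_inv_smul, hσ₂']
    · have hsu : IsUnit s := isUnit_of_dvd_one (hθx.2.2 (by norm_num))
      have hra : r ∣ a₂ := hθy.2.1 (by norm_num)
      have har : a₂ ∣ r := by
        have h := dvd_coeff_toSkew (φ (x σ₁ a₁)) (j := -1) (by norm_num)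
        rwa [hr, coeff_single, Finsupp.single_eq_same] at h
      rw [← hsr, neg_neg, zpow_one, g_smul]
      exact ((associated_of_dvd_dvd har hra).map σ₂).trans
        (associated_unit_mul_right _ s hsu)

/-- A map with `h ↦ α hᵉ`, where `e = ±1`, is an automorphism of `k[h^{±1}]`. -/
theorem exists_algEquiv_of_apply_T {ψ : LaurentPolynomial k →ₐ[k] LaurentPolynomial k} {α : k}
    {i : ℤ} (hα : α ≠ 0) (hi : i = 1 ∨ i = -1) (hψ : ψ (T 1) = C α * T i) :
    ∃ Ψ : LaurentPolynomial k ≃ₐ[k] LaurentPolynomial k, ∀ p, Ψ p = ψ p := by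
  have hα' : α ^ (-i) ≠ 0 := zpow_ne_zero _ hα
  obtain ⟨ψ', h⟩ := exists_algHom_T (k := k) (isUnit_C_mul_T hα' i).unit
  have hψ' : ψ' (T 1) = C (α ^ (-i)) * T i := h
  refine ⟨AlgEquiv.ofAlgHom ψ ψ' (algHom_ext_T ?_) (algHom_ext_T ?_), fun p ↦ rfl⟩
  · rw [AlgHom.comp_apply, hψ', algHom_C_mul_T hα hψ]
    rcases hi with rfl | rfl <;> simp [hα]
  · rw [AlgHom.comp_apply, hψ, algHom_C_mul_T hα' hψ']
    rcases hi with rfl | rfl <;> simp [hα]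

/-- A map with `h ↦ α hⁱ` is equivariant for the involutions `h ↦ q₁ h⁻¹` and `h ↦ q₂ h⁻¹` if and
only if `α² = q₁ q₂⁻ⁱ`. -/
theorem equivariant_iff (hq₂ : q₂ ≠ 0) (hσ₁ : σ₁ (T 1) = C q₁ * T (-1))
    (hσ₂ : σ₂ (T 1) = C q₂ * T (-1)) {ψ : LaurentPolynomial k →ₐ[k] LaurentPolynomial k} {α : k}
    {i : ℤ} (hα : α ≠ 0) (hψ : ψ (T 1) = C α * T i) :
    (∀ p, ψ (σ₁ p) = σ₂ (ψ p)) ↔ α ^ 2 = q₁ * q₂ ^ (-i) := by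
  have hσ₂' : (σ₂ : LaurentPolynomial k →ₐ[k] LaurentPolynomial k) (T 1) = C q₂ * T (-1) := hσ₂
  have hl : ψ (σ₁ (T 1)) = C (q₁ * α⁻¹) * T (-i) := by
    rw [hσ₁, algHom_C_mul_T hα hψ, zpow_neg_one, mul_neg_one]
  have hr : σ₂ (ψ (T 1)) = C (α * q₂ ^ i) * T (-i) := by
    rw [hψ, ← neg_one_mul i]
    exact algHom_C_mul_T hq₂ hσ₂' α i
  have hiff : α ^ 2 = q₁ * q₂ ^ (-i) ↔ α * q₂ ^ i = q₁ * α⁻¹ := by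
    rw [zpow_neg, ← div_eq_mul_inv, ← div_eq_mul_inv, eq_div_iff (zpow_ne_zero i hq₂),
      eq_div_iff hα, sq, mul_right_comm]
  rw [hiff]
  refine ⟨fun h ↦ ?_, fun h ↦ ?_⟩
  · have h' := h (T 1)
    rw [hl, hr] at h'
    exact (C_mul_T_inj (mul_ne_zero hα (zpow_ne_zero i hq₂)) h'.symm).1
  · have h' : ψ.comp (σ₁ : LaurentPolynomial k →ₐ[k] LaurentPolynomial k) =
        (σ₂ : LaurentPolynomial k →ₐ[k] LaurentPolynomial k).comp ψ :=
      algHom_ext_T (hl.trans (by rw [← h, ← hr]; rfl))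
    exact DFunLike.congr_fun h'

end Involution

end GWA

/-- Over a field of characteristic not `2`, let `q₁, q₂ ∈ k^*` each have a
square root in `k` and let `a₁, a₂` be nonzero Laurent polynomials.  The generalized Weyl
algebras `k[h^{±1}](σ_inv, a₁)` (`σ_inv(h) = q₁ h⁻¹`) and `k[h^{±1}](σ'_inv, a₂)`
(`σ'_inv(h) = q₂ h⁻¹`) are isomorphic iff there are `p ∈ k^*`, `l ∈ ℤ`, `τ ∈ {0, 1}`,
`ε ∈ {1, −1}` and `α` with `α² = q₁ q₂^{−ε}` such that
`a₂(q₂^τ h^{(−1)^τ}) = p hˡ a₁(α h^ε)`; substitutions are expressed via the `k`-algebra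
endomorphisms `φ, ψ` of `k[h^{±1}]` with `φ(h) = q₂^τ h^{(−1)^τ}` and `ψ(h) = α h^ε`. -/
theorem involution_gwa_isomorphism_problem (k : Type*) [Field k] (hchar : (2 : k) ≠ 0)
    (q₁ q₂ : k) (hq₁0 : q₁ ≠ 0) (hq₂0 : q₂ ≠ 0)
    (s₁ : k) (hs₁ : s₁ ^ 2 = q₁) (s₂ : k) (hs₂ : s₂ ^ 2 = q₂)
    (a₁ a₂ : LaurentPolynomial k) (ha₁ : a₁ ≠ 0) (ha₂ : a₂ ≠ 0)
    (σ₁ : LaurentPolynomial k ≃ₐ[k] LaurentPolynomial k) (hσ₁ : σ₁ (T 1) = C q₁ * T (-1))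
    (σ₂ : LaurentPolynomial k ≃ₐ[k] LaurentPolynomial k) (hσ₂ : σ₂ (T 1) = C q₂ * T (-1)) :
    Nonempty (GWA k σ₁ a₁ ≃ₐ[k] GWA k σ₂ a₂) ↔
      ∃ (p : k) (l : ℤ) (τ : ℕ) (ε : ℤ) (α : k)
        (φ ψ : LaurentPolynomial k →ₐ[k] LaurentPolynomial k),
        p ≠ 0 ∧ (τ = 0 ∨ τ = 1) ∧ (ε = 1 ∨ ε = -1) ∧ α ^ 2 = q₁ * q₂ ^ (-ε) ∧
          φ (T 1) = C (q₂ ^ τ) * T ((-1) ^ τ) ∧ ψ (T 1) = C α * T ε ∧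
          φ a₂ = C p * T l * ψ a₁ := by
  have hinv₂ := GWA.apply_apply_of_involution hq₂0 hσ₂
  have key {φ ψ : LaurentPolynomial k →ₐ[k] LaurentPolynomial k}
      (h : Associated (φ a₂) (ψ a₁)) : ∃ (p : k) (l : ℤ), p ≠ 0 ∧ φ a₂ = C p * T l * ψ a₁ := by
    obtain ⟨u, hu⟩ := h.symm
    obtain ⟨p, l, hp, hpu⟩ := isUnit_iff_exists_C_mul_T.1 u.isUnit
    exact ⟨p, l, hp, by rw [← hu, hpu, mul_comm]⟩
  constructor
  · rintro ⟨φ⟩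
    have hne {q : k} (hq : q ≠ 0) : (C q * T (-1) : LaurentPolynomial k) ≠ T 1 := fun h ↦ by
      have := (C_mul_T_inj (d := 1) (n := 1) hq (by rw [h, map_one, one_mul])).2
      omega
    by_cases hu₁ : IsUnit a₁
    · have hu₂ := GWA.isUnit_of_algEquiv (by rw [hσ₁]; exact hne hq₁0) ha₂ φ hu₁
      have hs₁0 : s₁ ≠ 0 := by rintro rfl; exact hq₁0 (by rw [← hs₁]; simp)
      have hs₂0 : s₂ ≠ 0 := by rintro rfl; exact hq₂0 (by rw [← hs₂]; simp)
      obtain ⟨ψ, hψ⟩ := exists_algHom_T (k := k) (isUnit_C_mul_T (div_ne_zero hs₁0 hs₂0) 1).unit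
      obtain ⟨p, l, hp, h⟩ := key (φ := AlgHom.id k _)
        ((associated_one_iff_isUnit.2 hu₂).trans (associated_one_iff_isUnit.2 (hu₁.map ψ)).symm)
      refine ⟨p, l, 0, 1, s₁ / s₂, AlgHom.id k _, ψ, hp, Or.inl rfl, Or.inl rfl, ?_, ?_, hψ, h⟩
      · rw [div_pow, hs₁, hs₂, zpow_neg_one, div_eq_mul_inv]
      · simp
    · have hu₂ : ¬IsUnit a₂ := fun hu₂ ↦
        hu₁ (GWA.isUnit_of_algEquiv (by rw [hσ₂]; exact hne hq₂0) ha₁ φ.symm hu₂)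
      obtain ⟨ψ, α, i, hα, hi, hψ, hequiv, h | h⟩ :=
        GWA.exists_associated_of_algEquiv ha₁ ha₂ hu₁ hu₂ hinv₂ φ
      · obtain ⟨p, l, hp, h⟩ := key (φ := AlgHom.id k _) h
        refine ⟨p, l, 0, i, α, AlgHom.id k _, ψ, hp, Or.inl rfl, hi,
          (GWA.equivariant_iff hq₂0 hσ₁ hσ₂ hα hψ).1 hequiv, ?_, hψ, h⟩
        simp
      · obtain ⟨p, l, hp, h⟩ :=
          key (φ := (σ₂ : LaurentPolynomial k →ₐ[k] LaurentPolynomial k)) h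
        refine ⟨p, l, 1, i, α, σ₂, ψ, hp, Or.inr rfl, hi,
          (GWA.equivariant_iff hq₂0 hσ₁ hσ₂ hα hψ).1 hequiv, ?_, hψ, h⟩
        rw [pow_one, pow_one]
        exact hσ₂
  · rintro ⟨p, l, τ, ε, α, φ, ψ, hp, hτ, hε, hα2, hφ, hψ, h⟩
    have hα : α ≠ 0 := by
      rintro rfl
      exact mul_ne_zero hq₁0 (zpow_ne_zero (-ε) hq₂0) (by rw [← hα2]; simp)
    have hequiv := (GWA.equivariant_iff hq₂0 hσ₁ hσ₂ hα hψ).2 hα2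
    obtain ⟨Ψ, hΨ⟩ := GWA.exists_algEquiv_of_apply_T hα hε hψ
    have hu := isUnit_C_mul_T hp l
    have hiso : Nonempty (GWA k σ₁ a₁ ≃ₐ[k] GWA k σ₂ (φ a₂)) :=
      GWA.nonempty_algEquiv_of_equivariant Ψ (fun p ↦ by rw [hΨ, hΨ, hequiv]) hu.unit⁻¹
        (by rw [hΨ, h, Units.eq_inv_mul_iff_mul_eq]; rfl)
    rcases hτ with rfl | rfl
    · have hφ' : φ = AlgHom.id k _ := algHom_ext_T (by rw [hφ]; simp)
      rw [hφ'] at hiso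
      exact hiso
    · have hφ' : φ = (σ₂ : LaurentPolynomial k →ₐ[k] LaurentPolynomial k) :=
        algHom_ext_T (by rw [hφ, pow_one, pow_one]; exact hσ₂.symm)
      rw [hφ'] at hiso
      obtain ⟨F⟩ := hiso
      obtain ⟨G⟩ := GWA.nonempty_algEquiv_swap (a := a₂) hinv₂
      exact ⟨F.trans G⟩
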